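/- arXiv:1006.5223 — 3 statements merged into one kernel-verified Lean document; each statement's English description precedes it below -/
import Mathlib

section
/- Let g, h ∈ SL(2,ℝ). If Tr(g·h·g⁻¹·h⁻¹) < 2, then |Tr g| > 2, |Tr h| > 2, and |Tr (g·h)| > 2 (that is, g, h and gh are all hyperbolic). -/
/-- The trace of an element of SL(2,ℝ), viewed as a 2×2 real matrix. -/
def trSL (g : Matrix.SpecialLinearGroup (Fin 2) ℝ) : ℝ :=
  Matrix.trace (g : Matrix (Fin 2) (Fin 2) ℝ)

open Matrix in
theorem trSL_commutator (g h : SpecialLinearGroup (Fin 2) ℝ) :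
    trSL (g * h * g⁻¹ * h⁻¹) =
      2 - ((g : Matrix (Fin 2) (Fin 2) ℝ) * h - (h : Matrix (Fin 2) (Fin 2) ℝ) * g).det := by
  have hg := g.det_coe
  have hh := h.det_coe
  rw [det_fin_two] at hg hh
  change trace ((g : Matrix (Fin 2) (Fin 2) ℝ) * (h : Matrix (Fin 2) (Fin 2) ℝ) *
    adjugate (g : Matrix (Fin 2) (Fin 2) ℝ) * adjugate (h : Matrix (Fin 2) (Fin 2) ℝ)) = _
  simp only [adjugate_fin_two, trace_fin_two, det_fin_two, mul_apply, Fin.sum_univ_two,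
    Matrix.sub_apply, of_apply, cons_val', cons_val_zero, cons_val_one, cons_val_fin_one]
  linear_combination 2 * (h 0 0 * h 1 1 - h 0 1 * h 1 0) * hg + 2 * hh

open Matrix in
/-- The commutator of `A` and `B` is traceless and orthogonal to `A` for the trace form, so its
determinant is nonpositive as soon as the discriminant of `A` is. -/
theorem det_mul_sub_mul_nonpos {A : Matrix (Fin 2) (Fin 2) ℝ} (B : Matrix (Fin 2) (Fin 2) ℝ)
    (hA : A.trace ^ 2 ≤ 4 * A.det) : (A * B - B * A).det ≤ 0 := by
  simp only [trace_fin_two, det_fin_two, mul_apply, Fin.sum_univ_two, Matrix.sub_apply] at hA ⊢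
  generalize A 0 0 = a, A 0 1 = b, A 1 0 = c, A 1 1 = d at *
  generalize B 0 0 = s, B 0 1 = t, B 1 0 = u, B 1 1 = v at *
  rcases eq_or_ne c 0 with rfl | hc
  · obtain rfl : a = d := by nlinarith [sq_nonneg (a - d)]
    nlinarith [sq_nonneg (b * u)]
  · refine nonpos_of_mul_nonpos_right (a := c ^ 2) ?_ (by positivity)
    have hdisc : 0 ≤ (c * s + d * u - (u * a + v * c)) ^ 2 *
        (4 * (a * d - b * c) - (a + d) ^ 2) :=
      mul_nonneg (sq_nonneg _) (by linarith)
    have hsq :=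
      sq_nonneg (c * (b * u - t * c) - (c * s + d * u - (u * a + v * c)) * (a - d) / 2)
    linarith

theorem two_lt_abs_trSL_of_commutator {g h : Matrix.SpecialLinearGroup (Fin 2) ℝ}
    (hcomm : trSL (g * h * g⁻¹ * h⁻¹) < 2) : 2 < |trSL g| := by
  by_contra! hg
  rw [trSL_commutator] at hcomm
  have hsq : trSL g ^ 2 ≤ 4 := by
    nlinarith [sq_abs (trSL g), abs_nonneg (trSL g)]
  have := det_mul_sub_mul_nonpos (A := g) h (by rw [g.det_coe]; simpa [trSL] using hsq)
  linarith

theorem trSL_commutator_comm (g h : Matrix.SpecialLinearGroup (Fin 2) ℝ) :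
    trSL (h * g * h⁻¹ * g⁻¹) = trSL (g * h * g⁻¹ * h⁻¹) := by
  rw [trSL_commutator, trSL_commutator,
    ← neg_sub ((g : Matrix (Fin 2) (Fin 2) ℝ) * h), Matrix.det_neg]
  simp

theorem trSL_commutator_mul_left (g h : Matrix.SpecialLinearGroup (Fin 2) ℝ) :
    trSL (g * h * h * (g * h)⁻¹ * h⁻¹) = trSL (g * h * g⁻¹ * h⁻¹) := by
  congr 1
  group

/-- If `Tr[g,h] < 2` then `g`, `h` and `g·h` are all hyperbolic, i.e. have
absolute value of trace greater than 2. -/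
theorem stmt2 (g h : Matrix.SpecialLinearGroup (Fin 2) ℝ)
    (hcomm : trSL (g * h * g⁻¹ * h⁻¹) < 2) :
    2 < |trSL g| ∧ 2 < |trSL h| ∧ 2 < |trSL (g * h)| := by
  refine ⟨two_lt_abs_trSL_of_commutator hcomm, two_lt_abs_trSL_of_commutator (h := g) ?_,
    two_lt_abs_trSL_of_commutator (h := h) ?_⟩
  · rwa [trSL_commutator_comm]
  · rwa [trSL_commutator_mul_left]
end

section
/- Let F₂ be the free group on two generators a, b, let ρ : F₂ → SL(2,ℝ) be a homomorphism, and let φ be an automorphism of F₂. Then the triple (Tr ρ(φ(a)), Tr ρ(φ(b)), Tr ρ(φ(a·b))) is equivalent to the triple (Tr ρ(a), Tr ρ(b), Tr ρ(a·b)) under the equivalence relation on ℝ³ generated by permutations of the coordinates and the move (x,y,z) ∼ (x,y,xy−z). -/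
/-- The basic moves on triples of reals: transpositions of coordinates (which
generate all permutations of the coordinates) and the Markoff move
`(x,y,z) ↦ (x,y,xy−z)`. -/
def markoffMove : ℝ × ℝ × ℝ → ℝ × ℝ × ℝ → Prop := fun p q =>
  q = (p.2.1, p.1, p.2.2) ∨
  q = (p.1, p.2.2, p.2.1) ∨
  q = (p.1, p.2.1, p.1 * p.2.1 - p.2.2)

namespace FreeGroup

section Norm

variable {α : Type*} [DecidableEq α]

theorem IsReduced.invRev {L : List (α × Bool)} (h : IsReduced L) :
    IsReduced (FreeGroup.invRev L) := by
  rw [isReduced_iff_reduce_eq] at h ⊢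
  rw [reduce_invRev, h]

theorem exists_common_prefix {L₁ L₂ : List (α × Bool)} (h₁ : IsReduced L₁)
    (h₂ : IsReduced L₂) :
    ∃ p s t, L₁ = p ++ s ∧ L₂ = p ++ t ∧ IsReduced (FreeGroup.invRev s ++ t) := by
  induction L₁ generalizing L₂ with
  | nil => exact ⟨[], [], L₂, rfl, rfl, by simpa using h₂⟩
  | cons a L₁ ih =>
    cases L₂ with
    | nil => exact ⟨[], a :: L₁, [], rfl, rfl, by simpa using h₁.invRev⟩
    | cons b L₂ =>
      by_cases hab : a = b
      · subst hab
        obtain ⟨p, s, t, rfl, rfl, h⟩ :=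
          ih (h₁.infix (List.infix_cons List.infix_rfl)) (h₂.infix (List.infix_cons List.infix_rfl))
        exact ⟨a :: p, s, t, rfl, rfl, h⟩
      · refine ⟨[], a :: L₁, b :: L₂, rfl, rfl, ?_⟩
        have h := h₁.invRev
        rw [invRev_cons] at h ⊢
        refine h.append_overlap ?_ (by simp [FreeGroup.invRev])
        have : FreeGroup.invRev [a] ++ b :: L₂ = (a.1, !a.2) :: b :: L₂ := by
          simp [FreeGroup.invRev]
        rw [this, isReduced_cons_cons]
        refine ⟨fun h1 => ?_, h₂⟩
        by_contra h2
        exact hab (Prod.ext h1 (by revert h2; cases a.2 <;> cases b.2 <;> simp))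

/-- Twice the Gromov product of `x` and `y` based at `1` in the Cayley tree, that is, twice the
length of the longest common prefix of the reduced words of `x` and `y`. -/
def gromov (x y : FreeGroup α) : ℤ := norm x + norm y - norm (x⁻¹ * y)

theorem exists_toWord_eq_append (x y : FreeGroup α) :
    ∃ p s t, x.toWord = p ++ s ∧ y.toWord = p ++ t ∧ norm (x⁻¹ * y) = s.length + t.length := by
  obtain ⟨p, s, t, hx, hy, h⟩ :=
    exists_common_prefix (isReduced_toWord (x := x)) (isReduced_toWord (x := y))
  refine ⟨p, s, t, hx, hy, ?_⟩
  have : x⁻¹ * y = mk (FreeGroup.invRev s ++ t) := by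
    rw [← mk_toWord (x := x), ← mk_toWord (x := y), hx, hy, ← mul_mk, ← mul_mk, ← mul_mk, ← inv_mk]
    group
  rw [this, norm, toWord_mk, h.reduce_eq]
  simp

theorem le_gromov_of_toWord {x y : FreeGroup α} {p s t : List (α × Bool)}
    (hx : x.toWord = p ++ s) (hy : y.toWord = p ++ t) : 2 * (p.length : ℤ) ≤ gromov x y := by
  have h : x⁻¹ * y = mk (FreeGroup.invRev s ++ t) := by
    rw [← mk_toWord (x := x), ← mk_toWord (x := y), hx, hy, ← mul_mk, ← mul_mk, ← mul_mk, ← inv_mk]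
    group
  have h1 : norm (x⁻¹ * y) ≤ s.length + t.length := by
    rw [h]; exact norm_mk_le.trans (by simp)
  have h2 : norm x = p.length + s.length := by simp [norm, hx]
  have h3 : norm y = p.length + t.length := by simp [norm, hy]
  unfold gromov
  omega

theorem exists_gromov_eq (x y : FreeGroup α) :
    ∃ p s t, x.toWord = p ++ s ∧ y.toWord = p ++ t ∧ gromov x y = 2 * (p.length : ℤ) := by
  obtain ⟨p, s, t, hx, hy, h⟩ := exists_toWord_eq_append x y
  refine ⟨p, s, t, hx, hy, ?_⟩
  have h2 : norm x = p.length + s.length := by simp [norm, hx]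
  have h3 : norm y = p.length + t.length := by simp [norm, hy]
  unfold gromov
  omega

theorem gromov_comm (x y : FreeGroup α) : gromov x y = gromov y x := by
  have : norm (x⁻¹ * y) = norm (y⁻¹ * x) := by rw [← norm_inv_eq]; simp
  unfold gromov
  omega

theorem gromov_nonneg (x y : FreeGroup α) : 0 ≤ gromov x y := by
  obtain ⟨p, s, t, -, -, h⟩ := exists_gromov_eq x y
  omega

theorem even_gromov (x y : FreeGroup α) : 2 ∣ gromov x y := by
  obtain ⟨p, s, t, -, -, h⟩ := exists_gromov_eq x y
  omega

/-- The Cayley tree of a free group is `0`-hyperbolic. -/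
theorem le_gromov_trans {x y z : FreeGroup α} {n : ℤ} (hxy : n ≤ gromov x y)
    (hyz : n ≤ gromov y z) : n ≤ gromov x z := by
  obtain ⟨p, s, t, hx, hy, h⟩ := exists_gromov_eq x y
  obtain ⟨q, s', t', hy', hz, h'⟩ := exists_gromov_eq y z
  rw [hy'] at hy
  rcases List.append_eq_append_iff.1 hy with ⟨r, rfl, -⟩ | ⟨r, rfl, -⟩
  · rw [List.append_assoc] at hx
    have := le_gromov_of_toWord hx hz
    omega
  · rw [List.append_assoc] at hz
    have := le_gromov_of_toWord hx hz
    omega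

theorem norm_lt_norm_mul_self {u : FreeGroup α} (hu : u ≠ 1) : norm u < norm (u * u) := by
  have h := reduceCyclically.conj_conjugator_reduceCyclically u.toWord
  have h2 := reduceCyclically.reduce_flatten_replicate_succ (isReduced_toWord (x := u)) 1
  have h1 : norm (u * u) = (reduce (List.replicate (1 + 1) u.toWord).flatten).length := by
    rw [norm, toWord_mul]; simp [List.replicate]
  have h3 : norm u = (reduceCyclically.conjugator u.toWord ++ reduceCyclically u.toWord ++
      FreeGroup.invRev (reduceCyclically.conjugator u.toWord)).length := by rw [h]; rfl
  rw [h1, h2, h3]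
  have h4 : 0 < (reduceCyclically u.toWord).length := by
    rw [List.length_pos_iff]
    intro h5
    apply hu
    rw [← mk_toWord (x := u), ← h, h5, ← mul_mk, ← mul_mk, ← inv_mk, ← one_eq_mk]
    group
  simp [List.replicate]
  omega

theorem exists_mul_eq_of_le_norm {u : FreeGroup α} {k : ℕ} (hk : k ≤ norm u) :
    ∃ p s, u = p * s ∧ norm p = k ∧ norm s = norm u - k := by
  refine ⟨mk (u.toWord.take k), mk (u.toWord.drop k), ?_, ?_, ?_⟩
  · rw [mul_mk, List.take_append_drop, mk_toWord]
  · rw [norm, toWord_mk,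
      (isReduced_toWord.infix (List.take_prefix k u.toWord).isInfix).reduce_eq, List.length_take]
    exact min_eq_left hk
  · rw [norm, toWord_mk,
      (isReduced_toWord.infix (List.drop_suffix k u.toWord).isInfix).reduce_eq, List.length_drop]
    rfl

theorem gromov_inv_self_lt {u : FreeGroup α} (hu : u ≠ 1) : gromov u⁻¹ u < norm u := by
  have := norm_lt_norm_mul_self hu
  simp only [gromov, inv_inv, norm_inv_eq]
  omega

/-- If the images of the letters under `ψ` satisfy Nielsen's condition on triple products, then
`ψ` does not decrease the length of reduced words. -/
theorem length_le_norm_map_mk {ι : Type*} (ψ : FreeGroup ι →* FreeGroup α)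
    (hψ : ∀ l m k : ι × Bool, m ≠ l → k ≠ (l.1, !l.2) →
      gromov (ψ (mk [m])) (ψ (mk [l])) + gromov (ψ (mk [l]))⁻¹ (ψ (mk [k])) <
        2 * norm (ψ (mk [l])))
    {L : List (ι × Bool)} (hL : IsReduced L) : L.length ≤ norm (ψ (mk L)) := by
  have hne : ∀ l : ι × Bool, (l.1, !l.2) ≠ l := fun l h => by
    have := congrArg Prod.snd h
    simp at this
  have hinv : ∀ l : ι × Bool, ψ (mk [(l.1, !l.2)]) = (ψ (mk [l]))⁻¹ := fun l => by
    rw [← _root_.map_inv, inv_mk]; rfl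
  have main : ∀ (L : List (ι × Bool)) (l : ι × Bool), IsReduced (l :: L) → ∀ m, m ≠ l →
      2 * ((l :: L).length : ℤ) ≤
        2 * norm (ψ (mk (l :: L))) - gromov (ψ (mk [m])) (ψ (mk [l])) ∧
      gromov (ψ (mk [m])) (ψ (mk (l :: L))) ≤ gromov (ψ (mk [m])) (ψ (mk [l])) := by
    intro L
    induction L with
    | nil =>
      intro l _ m hm
      have h1 := hψ l m l hm (hne l).symm
      have h2 := gromov_nonneg (ψ (mk [l]))⁻¹ (ψ (mk [l]))
      have h3 := even_gromov (ψ (mk [m])) (ψ (mk [l]))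
      refine ⟨?_, le_rfl⟩
      simp only [List.length_singleton]
      omega
    | cons k L ih =>
      intro l hl m hm
      rw [isReduced_cons_cons] at hl
      have hk : k ≠ (l.1, !l.2) := by
        rintro rfl
        simpa using hl.1 rfl
      obtain ⟨ih1, ih2⟩ := ih k hl.2 (l.1, !l.2) hk.symm
      rw [hinv] at ih1 ih2
      have hlmk := hψ l m k hm hk
      have hW : ψ (mk (l :: k :: L)) = ψ (mk [l]) * ψ (mk (k :: L)) := by
        rw [← _root_.map_mul, mul_mk]; rfl
      rw [hW]
      generalize ψ (mk (k :: L)) = W at *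
      have e1 : gromov (ψ (mk [l]))⁻¹ W = norm (ψ (mk [l])) + norm W - norm (ψ (mk [l]) * W) := by
        simp [gromov]
      have e2 : gromov (ψ (mk [l]) * W) (ψ (mk [l])) =
          norm (ψ (mk [l]) * W) + norm (ψ (mk [l])) - norm W := by
        rw [gromov_comm]; simp [gromov]; ring
      have h3 := even_gromov (ψ (mk [m])) (ψ (mk [l]))
      have h4 := even_gromov (ψ (mk [l]))⁻¹ (ψ (mk [k]))
      constructor
      · simp only [List.length_cons] at ih1 ⊢
        push_cast at ih1 ⊢
        omega
      · by_contra! h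
        have := le_gromov_trans (n := gromov (ψ (mk [m])) (ψ (mk [l])) + 1)
          (x := ψ (mk [m])) (y := ψ (mk [l]) * W) (z := ψ (mk [l])) (by omega) (by omega)
        omega
  cases L with
  | nil => simp
  | cons l L =>
    have h1 := (main L l hL (l.1, !l.2) (hne l)).1
    have h2 := gromov_nonneg (ψ (mk [(l.1, !l.2)])) (ψ (mk [l]))
    omega

end Norm

/-- A relation on a group closed under the elementary Nielsen moves and simultaneous
conjugation. -/
structure NielsenClosed {G : Type*} [Group G] (R : G → G → Prop) : Prop where
  swap : ∀ {u v}, R u v → R v u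
  inv_left : ∀ {u v}, R u v → R u⁻¹ v
  mul_right : ∀ {u v}, R u v → R u (u * v)
  conj : ∀ {u v} (g : G), R u v → R (g * u * g⁻¹) (g * v * g⁻¹)

theorem NielsenClosed.and {G : Type*} [Group G] {R S : G → G → Prop} (hR : NielsenClosed R)
    (hS : NielsenClosed S) : NielsenClosed fun u v => R u v ∧ S u v where
  swap h := ⟨hR.swap h.1, hS.swap h.2⟩
  inv_left h := ⟨hR.inv_left h.1, hS.inv_left h.2⟩
  mul_right h := ⟨hR.mul_right h.1, hS.mul_right h.2⟩
  conj g h := ⟨hR.conj g h.1, hS.conj g h.2⟩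

section Minimal

variable {α : Type*} [DecidableEq α] {R : FreeGroup α → FreeGroup α → Prop}
  {u v : FreeGroup α}

/-- A pair related by `R` whose total length is minimal among such pairs. -/
def IsMinimalPair (R : FreeGroup α → FreeGroup α → Prop) (u v : FreeGroup α) : Prop :=
  R u v ∧ ∀ u' v', R u' v' → norm u + norm v ≤ norm u' + norm v'

namespace IsMinimalPair

theorem swap (hR : NielsenClosed R) (h : IsMinimalPair R u v) : IsMinimalPair R v u :=
  ⟨hR.swap h.1, fun u' v' h' => by have := h.2 u' v' h'; omega⟩

theorem inv_left (hR : NielsenClosed R) (h : IsMinimalPair R u v) : IsMinimalPair R u⁻¹ v :=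
  ⟨hR.inv_left h.1, by simpa only [norm_inv_eq] using h.2⟩

theorem inv_right (hR : NielsenClosed R) (h : IsMinimalPair R u v) : IsMinimalPair R u v⁻¹ :=
  ((h.swap hR).inv_left hR).swap hR

theorem norm_le_norm_mul (hR : NielsenClosed R) (h : IsMinimalPair R u v) :
    norm v ≤ norm (u * v) := by
  have := h.2 _ _ (hR.mul_right h.1)
  omega

theorem gromov_le_left (hR : NielsenClosed R) (h : IsMinimalPair R u v) :
    gromov u v ≤ norm u := by
  have := (h.inv_left hR).norm_le_norm_mul hR
  unfold gromov
  omega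

theorem gromov_le_right (hR : NielsenClosed R) (h : IsMinimalPair R u v) :
    gromov u v ≤ norm v := by
  rw [gromov_comm]
  exact (h.swap hR).gromov_le_left hR

theorem gromov_add_gromov_lt (hR : NielsenClosed R) (h : IsMinimalPair R u v) (hu : u ≠ 1) :
    gromov v⁻¹ u + gromov u⁻¹ v < 2 * norm u := by
  have h1 := ((h.inv_right hR).swap hR).gromov_le_right hR
  have h1' := ((h.inv_right hR).swap hR).gromov_le_left hR
  have h2 := (h.inv_left hR).gromov_le_left hR
  rw [norm_inv_eq] at h2 h1'
  by_contra! hcon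
  have e1 : gromov v⁻¹ u = norm u := by omega
  have e2 : gromov u⁻¹ v = norm u := by omega
  obtain ⟨k, hk⟩ := even_gromov v⁻¹ u
  lift k to ℕ using by omega
  obtain ⟨p, s, rfl, hp, hs⟩ := exists_mul_eq_of_le_norm (u := u) (k := k) (by omega)
  have hs' : norm s = k := by omega
  -- `p` is a prefix of `v⁻¹`, and `s⁻¹` is a prefix of `v`
  have a1 : gromov v⁻¹ p = 2 * k := by
    refine le_antisymm ?_ (le_gromov_trans (y := p * s) (by omega) ?_)
    · have h3 : norm v ≤ norm (v * p) + norm p := by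
        simpa using norm_mul_le (v * p) p⁻¹
      simp only [gromov, inv_inv, norm_inv_eq]
      omega
    · rw [gromov_comm]
      simp only [gromov, inv_mul_cancel_left]
      omega
  have a2 : 2 * (k : ℤ) ≤ gromov s⁻¹ v := by
    refine le_gromov_trans (y := (p * s)⁻¹) ?_ (by omega)
    have : s⁻¹⁻¹ * (p * s)⁻¹ = p⁻¹ := by group
    simp only [gromov, this, norm_inv_eq]
    omega
  have a3 : norm (s * v) ≤ norm v - k := by
    simp only [gromov, inv_inv, norm_inv_eq] at a2
    omega
  have a4 : 2 * (k : ℤ) ≤ gromov p (v⁻¹ * s⁻¹) := by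
    refine le_gromov_trans (y := v⁻¹) (by rw [gromov_comm]; omega) ?_
    have h3 : norm (v⁻¹ * s⁻¹) = norm (s * v) := by rw [← norm_inv_eq]; simp
    have h4 : norm v ≤ norm s + norm (s * v) := by
      simpa using norm_mul_le s⁻¹ (s * v)
    have h5 : v⁻¹⁻¹ * (v⁻¹ * s⁻¹) = s⁻¹ := by group
    simp only [gromov, h5, norm_inv_eq, h3]
    omega
  have a5 : norm (s * v * p) + 2 * k ≤ norm v := by
    have h3 : norm (v⁻¹ * s⁻¹) = norm (s * v) := by rw [← norm_inv_eq]; simp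
    have h4 : norm (p⁻¹ * (v⁻¹ * s⁻¹)) = norm (s * v * p) := by
      rw [← norm_inv_eq]; simp [mul_assoc]
    simp only [gromov, h3, h4] at a4
    omega
  have := h.2 _ _ (hR.conj p⁻¹ (hR.mul_right h.1))
  have b1 : p⁻¹ * (p * s) * p⁻¹⁻¹ = s * p := by group
  have b2 : p⁻¹ * (p * s * v) * p⁻¹⁻¹ = s * v * p := by group
  rw [b1, b2] at this
  have b3 := norm_mul_le s p
  have b4 : norm (p * s) ≠ 0 := fun h0 => hu (norm_eq_zero.1 h0)
  omega

theorem gromov_add_gromov_self_lt (hR : NielsenClosed R) (h : IsMinimalPair R u v) (hu : u ≠ 1) :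
    gromov v u + gromov u⁻¹ v < 2 * norm u := by
  have h1 := (h.swap hR).gromov_le_right hR
  have h2 := (h.inv_left hR).gromov_le_left hR
  rw [norm_inv_eq] at h2
  have h3 := gromov_inv_self_lt hu
  by_contra! hcon
  have := le_gromov_trans (n := norm u) (x := u⁻¹) (y := v) (z := u) (by omega) (by omega)
  omega

/-- Nielsen's condition on triple products holds for minimal pairs. -/
theorem triple_lt (hR : NielsenClosed R) (h : IsMinimalPair R u v) (hu : u ≠ 1)
    {x z : FreeGroup α} (hx : x = u⁻¹ ∨ x = v ∨ x = v⁻¹) (hz : z = u ∨ z = v ∨ z = v⁻¹) :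
    gromov x u + gromov u⁻¹ z < 2 * norm u := by
  have h0 := gromov_inv_self_lt hu
  have hv := h.inv_right hR
  have h1 := (h.swap hR).gromov_le_right hR
  have h2 := (h.inv_left hR).gromov_le_left hR
  have h1' := (hv.swap hR).gromov_le_right hR
  have h2' := (hv.inv_left hR).gromov_le_left hR
  rw [norm_inv_eq] at h2 h2'
  have h3 := h.gromov_add_gromov_lt hR hu
  have h3' := hv.gromov_add_gromov_lt hR hu
  rw [inv_inv] at h3'
  have h4 := h.gromov_add_gromov_self_lt hR hu
  have h4' := hv.gromov_add_gromov_self_lt hR hu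
  rcases hx with rfl | rfl | rfl <;> rcases hz with rfl | rfl | rfl <;> omega

end IsMinimalPair

end Minimal

section RankTwo

variable {R : FreeGroup (Fin 2) → FreeGroup (Fin 2) → Prop}

theorem fst_ne_one_of_generates {u v : FreeGroup (Fin 2)}
    (h : Subgroup.closure {u, v} = ⊤) : u ≠ 1 := by
  rintro rfl
  have hz : ∀ g : FreeGroup (Fin 2), g ∈ Subgroup.zpowers v := fun g => by
    have : Subgroup.closure {1, v} ≤ Subgroup.zpowers v := by
      rw [Subgroup.closure_le]
      rintro x (rfl | rfl)
      · exact one_mem _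
      · exact Subgroup.mem_zpowers _
    exact this (h ▸ Subgroup.mem_top g)
  obtain ⟨m, hm⟩ := Subgroup.mem_zpowers_iff.1 (hz (of 0))
  obtain ⟨n, hn⟩ := Subgroup.mem_zpowers_iff.1 (hz (of 1))
  have : (of 0 * of 1 : FreeGroup (Fin 2)) = of 1 * of 0 := by
    rw [← hm, ← hn, ← zpow_add, ← zpow_add, add_comm]
  revert this
  decide

/-- Nielsen's theorem in rank two: a nonempty Nielsen-closed relation on `F₂`, all of whose pairs
generate `F₂`, relates the standard generators. -/
theorem rel_of_zero_of_one_of_nielsenClosed (hR : NielsenClosed R)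
    (hgen : ∀ {u v}, R u v → Subgroup.closure {u, v} = ⊤) (hne : ∃ u v, R u v) :
    R (of 0) (of 1) := by
  obtain ⟨u, v, h⟩ : ∃ u v, IsMinimalPair R u v := by
    obtain ⟨u₀, v₀, h₀⟩ := hne
    obtain ⟨⟨u, v⟩, h, hmin⟩ := WellFounded.has_min
      (measure fun q : FreeGroup (Fin 2) × FreeGroup (Fin 2) => norm q.1 + norm q.2).wf
      {q | R q.1 q.2} ⟨(u₀, v₀), h₀⟩
    exact ⟨u, v, h, fun u' v' h' => not_lt.1 (hmin (u', v') h')⟩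
  have hu := fst_ne_one_of_generates (hgen h.1)
  have hv := fst_ne_one_of_generates (hgen (hR.swap h.1))
  let ψ : FreeGroup (Fin 2) →* FreeGroup (Fin 2) := lift ![u, v]
  have y0 : ψ (mk [(0, true)]) = u := by simp [ψ]
  have y1 : ψ (mk [(1, true)]) = v := by simp [ψ]
  have y0' : ψ (mk [(0, false)]) = u⁻¹ := by simp [ψ]
  have y1' : ψ (mk [(1, false)]) = v⁻¹ := by simp [ψ]
  have hsurj : ∀ g, ∃ w, ψ w = g := by
    have : ψ.range = ⊤ := by
      rw [eq_top_iff, ← hgen h.1, Subgroup.closure_le]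
      rintro x (rfl | rfl)
      · exact ⟨_, y0⟩
      · exact ⟨_, y1⟩
    exact MonoidHom.range_eq_top.1 this
  have hψ : ∀ l m k : Fin 2 × Bool, m ≠ l → k ≠ (l.1, !l.2) →
      gromov (ψ (mk [m])) (ψ (mk [l])) + gromov (ψ (mk [l]))⁻¹ (ψ (mk [k])) <
        2 * norm (ψ (mk [l])) := by
    have hpair : ∀ l : Fin 2 × Bool,
        IsMinimalPair R (ψ (mk [l])) (ψ (mk [(1 - l.1, true)])) ∧ ψ (mk [l]) ≠ 1 := by
      simp [Prod.forall, Fin.forall_fin_two, y0, y1, y0', y1', hu, hv, h, h.swap hR,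
        h.inv_left hR, (h.swap hR).inv_left hR]
    have hletter : ∀ l m : Fin 2 × Bool, m ≠ l → ψ (mk [m]) = (ψ (mk [l]))⁻¹ ∨
        ψ (mk [m]) = ψ (mk [(1 - l.1, true)]) ∨ ψ (mk [m]) = (ψ (mk [(1 - l.1, true)]))⁻¹ := by
      simp [Prod.forall, Fin.forall_fin_two, y0, y1, y0', y1']
    intro l m k hm hk
    have hk' := hletter (l.1, !l.2) k hk
    have hinv : (ψ (mk [(l.1, !l.2)]))⁻¹ = ψ (mk [l]) := by
      rw [← _root_.map_inv, inv_mk]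
      simp [FreeGroup.invRev]
    rw [hinv] at hk'
    exact (hpair l).1.triple_lt hR (hpair l).2 (hletter l m hm) hk'
  have hlet : ∀ i : Fin 2, ∃ l, ψ (mk [l]) = of i := fun i => by
    obtain ⟨w, hw⟩ := hsurj (of i)
    have hlen := length_le_norm_map_mk ψ hψ (isReduced_toWord (x := w))
    rw [mk_toWord, hw, norm_of] at hlen
    rw [← mk_toWord (x := w)] at hw
    rcases hw' : w.toWord with _ | ⟨l, _ | ⟨m, L⟩⟩
    · rw [hw', ← one_eq_mk, _root_.map_one] at hw
      exact absurd hw.symm (of_ne_one i)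
    · exact ⟨l, hw' ▸ hw⟩
    · simp [hw'] at hlen
  obtain ⟨⟨i, b⟩, hl⟩ := hlet 0
  obtain ⟨⟨j, c⟩, hm⟩ := hlet 1
  have inv_right : ∀ {u v}, R u v → R u v⁻¹ := fun h => hR.swap (hR.inv_left (hR.swap h))
  have hab : (of 0 : FreeGroup (Fin 2)) ≠ of 1 := by decide
  have hab' : (of 0 : FreeGroup (Fin 2))⁻¹ ≠ of 1 := by decide
  have hab'' : (of 0 : FreeGroup (Fin 2)) ≠ (of 1)⁻¹ := by decide
  have hij : i ≠ j := by
    rintro rfl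
    have hinv : ψ (mk [(i, false)]) = (ψ (mk [(i, true)]))⁻¹ := by
      rw [← _root_.map_inv, inv_mk]; rfl
    cases b <;> cases c <;> simp_all
  have hrel : R (ψ (mk [(i, b)])) (ψ (mk [(j, c)])) := by
    revert hij
    clear hl hm
    revert i j b c
    simp [Fin.forall_fin_two, y0, y1, y0', y1', h.1, inv_right h.1, hR.swap h.1, hR.inv_left h.1,
      inv_right (hR.inv_left h.1), inv_right (hR.swap h.1), hR.inv_left (hR.swap h.1),
      inv_right (hR.inv_left (hR.swap h.1))]
  rwa [hl, hm] at hrel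

end RankTwo

end FreeGroup

theorem trSL_mul_comm (g h : Matrix.SpecialLinearGroup (Fin 2) ℝ) :
    trSL (g * h) = trSL (h * g) := by
  simp [trSL, Matrix.trace_mul_comm (g : Matrix (Fin 2) (Fin 2) ℝ)]

theorem trSL_inv (g : Matrix.SpecialLinearGroup (Fin 2) ℝ) : trSL g⁻¹ = trSL g := by
  simp [trSL, Matrix.adjugate_fin_two, Matrix.trace_fin_two, add_comm]

theorem trSL_inv_mul (g h : Matrix.SpecialLinearGroup (Fin 2) ℝ) :
    trSL (g⁻¹ * h) = trSL g * trSL h - trSL (g * h) := by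
  simp [trSL, Matrix.adjugate_fin_two, Matrix.trace_fin_two, Matrix.mul_apply, Matrix.vecMul,
    dotProduct, Fin.sum_univ_two]
  ring

theorem trSL_conj (g h : Matrix.SpecialLinearGroup (Fin 2) ℝ) :
    trSL (g * h * g⁻¹) = trSL h := by
  rw [trSL_mul_comm, inv_mul_cancel_left]

/-- The character triple of a pair of elements of `SL(2,ℝ)`. -/
def charTriple (g h : Matrix.SpecialLinearGroup (Fin 2) ℝ) : ℝ × ℝ × ℝ :=
  (trSL g, trSL h, trSL (g * h))

theorem nielsenClosed_generates {G : Type*} [Group G] :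
    FreeGroup.NielsenClosed fun u v : G => Subgroup.closure {u, v} = ⊤ := by
  have key : ∀ {u v u' v' : G}, Subgroup.closure {u, v} = ⊤ →
      u ∈ Subgroup.closure {u', v'} → v ∈ Subgroup.closure {u', v'} →
      Subgroup.closure {u', v'} = ⊤ := fun h hu hv => by
    rw [eq_top_iff, ← h, Subgroup.closure_le]
    rintro x (rfl | rfl)
    exacts [hu, hv]
  have left : ∀ u v : G, u ∈ Subgroup.closure {u, v} := fun u v =>
    Subgroup.subset_closure (by simp)
  have right : ∀ u v : G, v ∈ Subgroup.closure {u, v} := fun u v =>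
    Subgroup.subset_closure (by simp)
  refine ⟨fun h => key h (right _ _) (left _ _),
    fun h => key h (inv_mem_iff.1 (left _ _)) (right _ _),
    fun {u v} h => key h (left _ _) ?_, fun {u v} g h => ?_⟩
  · simpa using mul_mem (inv_mem (left u (u * v))) (right u (u * v))
  · have hmap := congrArg (Subgroup.map (MulAut.conj g).toMonoidHom) h
    rw [MonoidHom.map_closure, Set.image_pair,
      Subgroup.map_top_of_surjective _ (MulAut.conj g).surjective] at hmap
    simpa using hmap

theorem nielsenClosed_eqvGen_charTriple {G : Type*} [Group G]
    (ρ : G →* Matrix.SpecialLinearGroup (Fin 2) ℝ) (t : ℝ × ℝ × ℝ) :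
    FreeGroup.NielsenClosed fun u v => Relation.EqvGen markoffMove t (charTriple (ρ u) (ρ v)) where
  swap {u v} h := by
    refine h.trans _ _ _ (.rel _ _ (Or.inl ?_))
    simp [charTriple, trSL_mul_comm (ρ v)]
  inv_left {u v} h := by
    refine h.trans _ _ _ (.rel _ _ (Or.inr (Or.inr ?_)))
    simp [charTriple, trSL_inv, trSL_inv_mul]
  mul_right {u v} h := by
    have h1 := trSL_inv_mul (ρ u) (ρ u * ρ v)
    rw [inv_mul_cancel_left] at h1
    refine (h.trans _ _ _ (.rel _ _ (Or.inr (Or.inl rfl)))).trans _ _ _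
      (.rel _ _ (Or.inr (Or.inr ?_)))
    simp only [charTriple, map_mul, h1]
    ring_nf
  conj {u v} g h := by
    have : ρ (g * u * g⁻¹) * ρ (g * v * g⁻¹) = ρ g * (ρ u * ρ v) * (ρ g)⁻¹ := by
      simp only [map_mul, map_inv]; group
    rw [charTriple, this]
    simpa only [map_mul, map_inv, trSL_conj, charTriple] using h

/-- If `ρ : F₂ → SL(2,ℝ)` is a homomorphism and `φ` is an automorphism of the
free group `F₂ = ⟨a,b⟩`, then the character triple of `ρ ∘ φ` is equivalent to
that of `ρ` under the equivalence relation generated by permutations of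
coordinates and the Markoff move `(x,y,z) ∼ (x,y,xy−z)`. -/
theorem stmt13 (ρ : FreeGroup (Fin 2) →* Matrix.SpecialLinearGroup (Fin 2) ℝ)
    (φ : MulAut (FreeGroup (Fin 2))) :
    Relation.EqvGen markoffMove
      (trSL (ρ (φ (FreeGroup.of 0))), trSL (ρ (φ (FreeGroup.of 1))),
        trSL (ρ (φ (FreeGroup.of 0 * FreeGroup.of 1))))
      (trSL (ρ (FreeGroup.of 0)), trSL (ρ (FreeGroup.of 1)),
        trSL (ρ (FreeGroup.of 0 * FreeGroup.of 1))) := by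
  let R : FreeGroup (Fin 2) → FreeGroup (Fin 2) → Prop := fun u v =>
    Subgroup.closure {u, v} = ⊤ ∧ Relation.EqvGen markoffMove
      (charTriple (ρ (φ (FreeGroup.of 0))) (ρ (φ (FreeGroup.of 1)))) (charTriple (ρ u) (ρ v))
  have hR : FreeGroup.NielsenClosed R :=
    nielsenClosed_generates.and (nielsenClosed_eqvGen_charTriple ρ _)
  have hgen : Subgroup.closure {φ (FreeGroup.of 0), φ (FreeGroup.of 1)} = ⊤ := by
    have h := congrArg (Subgroup.map φ.toMonoidHom) (FreeGroup.closure_range_of (Fin 2))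
    rw [MonoidHom.map_closure, Subgroup.map_top_of_surjective _ φ.surjective] at h
    rw [← h]
    congr 1
    ext x
    simp [Fin.exists_fin_two, eq_comm]
  have h := (FreeGroup.rel_of_zero_of_one_of_nielsenClosed hR (fun h => h.1)
    ⟨_, _, hgen, .refl _⟩).2
  simpa only [charTriple, map_mul] using h
end

section
/- Let F₂ be the free group on two generators a, b. The natural homomorphism Aut(F₂) → GL₂(ℤ), given by the induced action of an automorphism on the abelianization of F₂ (which is free abelian of rank 2 with basis the images of a, b), is surjective, and its kernel is exactly the group of inner automorphisms of F₂. Consequently Out(F₂) ≅ GL₂(ℤ). -/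
/-- The exponent-sum of the generator `i` in a word of the free group `F₂`:
the `i`-th coordinate of the image in the abelianization `ℤ²` of `F₂`. -/
def expSum (i : Fin 2) : FreeGroup (Fin 2) →* Multiplicative ℤ :=
  FreeGroup.lift fun j => Multiplicative.ofAdd (if j = i then (1 : ℤ) else 0)

/-- The length of the longest common prefix of two lists. -/
def List.commonPrefixLength {β : Type*} [DecidableEq β] : List β → List β → ℕ
  | x :: xs, y :: ys => if x = y then commonPrefixLength xs ys + 1 else 0
  | _, _ => 0

theorem List.le_commonPrefixLength_iff {β : Type*} [DecidableEq β] {k : ℕ} {l m : List β} :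
    k ≤ l.commonPrefixLength m ↔ k ≤ l.length ∧ k ≤ m.length ∧ l.take k = m.take k := by
  induction l generalizing m k with
  | nil => cases m <;> cases k <;> simp [commonPrefixLength]
  | cons x xs ih =>
    cases m with
    | nil => cases k <;> simp [commonPrefixLength]
    | cons y ys =>
      cases k with
      | zero => simp
      | succ k =>
        by_cases h : x = y
        · simp [commonPrefixLength, h, ih]
        · simp [commonPrefixLength, h]

namespace FreeGroup

variable {α : Type*} [DecidableEq α]

theorem isReduced_invRev {L : List (α × Bool)} (h : IsReduced L) : IsReduced (invRev L) := by
  rw [isReduced_iff_reduce_eq, reduce_invRev, h.reduce_eq]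

theorem norm_inv_mk_mul_mk {L M : List (α × Bool)} (hL : IsReduced L) (hM : IsReduced M) :
    ((mk L)⁻¹ * mk M).norm + 2 * L.commonPrefixLength M = L.length + M.length := by
  induction L generalizing M with
  | nil =>
    cases M <;> simp [List.commonPrefixLength, norm, ← one_eq_mk, hM.reduce_eq]
  | cons x xs ih =>
    cases M with
    | nil =>
      simp [List.commonPrefixLength, ← one_eq_mk, norm, hL.reduce_eq, -inv_mk]
    | cons y ys =>
      by_cases h : x = y
      · subst h
        have e : (mk (x :: xs))⁻¹ * mk (x :: ys) = (mk xs)⁻¹ * mk ys := by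
          have : ∀ zs, mk (x :: zs) = mk [x] * mk zs := fun zs => by simp
          rw [this xs, this ys]
          group
        have := ih (hL.infix (List.suffix_cons x xs).isInfix)
          (hM.infix (List.suffix_cons x ys).isInfix)
        rw [e]
        simp only [List.commonPrefixLength, if_true, List.length_cons]
        omega
      · have hred : IsReduced (invRev (x :: xs) ++ y :: ys) := by
          refine List.IsChain.append (isReduced_invRev hL) hM ?_
          rintro a ha b hb
          simp [invRev] at ha hb
          subst ha hb
          intro h1
          simp only at h1 ⊢
          by_contra h2
          exact h (Prod.ext h1 (by simpa using h2))
        rw [inv_mk, mul_mk, norm, toWord_mk, hred.reduce_eq]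
        simp [List.commonPrefixLength, h]

/-- The number of letters cancelled in the product `g⁻¹ * h`, that is, the length of the longest
common prefix of the reduced words of `g` and `h`. -/
def cancel (g h : FreeGroup α) : ℕ := g.toWord.commonPrefixLength h.toWord

theorem norm_inv_mul_add (g h : FreeGroup α) :
    (g⁻¹ * h).norm + 2 * cancel g h = g.norm + h.norm := by
  have := norm_inv_mk_mul_mk (isReduced_toWord (x := g)) (isReduced_toWord (x := h))
  rwa [mk_toWord, mk_toWord] at this

theorem le_cancel_iff {k : ℕ} {g h : FreeGroup α} :
    k ≤ cancel g h ↔ k ≤ g.norm ∧ k ≤ h.norm ∧ g.toWord.take k = h.toWord.take k :=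
  List.le_commonPrefixLength_iff

theorem cancel_comm (g h : FreeGroup α) : cancel g h = cancel h g :=
  eq_of_forall_le_iff fun k => by
    rw [le_cancel_iff, le_cancel_iff]; tauto

theorem cancel_self (g : FreeGroup α) : cancel g g = g.norm :=
  eq_of_forall_le_iff fun k => by simp [le_cancel_iff]

theorem min_cancel_le (f g h : FreeGroup α) : min (cancel f g) (cancel g h) ≤ cancel f h := by
  obtain ⟨h1, _, h3⟩ := le_cancel_iff.1 (min_le_left (cancel f g) (cancel g h))
  obtain ⟨_, h5, h6⟩ := le_cancel_iff.1 (min_le_right (cancel f g) (cancel g h))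
  exact le_cancel_iff.2 ⟨h1, h5, h3.trans h6⟩

theorem two_mul_cancel_inv_self_lt {g : FreeGroup α} (hg : g ≠ 1) :
    2 * cancel g⁻¹ g < g.norm := by
  by_contra! hle
  have hpos : 0 < g.norm := Nat.pos_of_ne_zero fun h => hg (norm_eq_zero.1 h)
  obtain ⟨h1, -, h3⟩ := le_cancel_iff.1 (le_refl (cancel g⁻¹ g))
  set k := cancel g⁻¹ g
  rw [norm_inv_eq] at h1
  have hlen : g.toWord.length = g.norm := rfl
  have key : ∀ i (hi : i < k),
      (g.toWord[i]'(by omega)) = ((g.toWord[g.norm - 1 - i]'(by omega)).1,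
        !(g.toWord[g.norm - 1 - i]'(by omega)).2) := by
    intro i hi
    have := congrArg (fun l => l[i]?) h3
    simp only [List.getElem?_take, hi, if_true, toWord_inv] at this
    rw [List.getElem?_eq_getElem (by simp; omega), List.getElem?_eq_getElem (by omega)] at this
    simp only [Option.some.injEq, invRev, List.getElem_reverse, List.getElem_map,
      List.length_map] at this
    rw [← this]
    rfl
  have hred : IsReduced g.toWord := isReduced_toWord
  rcases Nat.even_or_odd' g.norm with ⟨m, hm | hm⟩
  · have h := key (m - 1) (by omega)
    have e : g.norm - 1 - (m - 1) = m - 1 + 1 := by omega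
    simp only [e] at h
    have := List.isChain_iff_getElem.1 hred (m - 1) (by omega)
    rw [h] at this
    simp at this
  · have h := key m (by omega)
    have e : g.norm - 1 - m = m := by omega
    simp only [e] at h
    have := congrArg Prod.snd h
    simp at this

/-- If exactly the two halves of `u` are cancelled by `v` on the left and on the right, then a
simultaneous conjugation and a multiplication shorten the pair. -/
theorem exists_shorter_of_half_cancel {u v : FreeGroup α}
    (h1 : 2 * cancel u v = u.norm) (h2 : 2 * cancel u⁻¹ v⁻¹ = u.norm) (h3 : u.norm ≤ v.norm) :
    ∃ g, (g * u * g⁻¹).norm + (g * (v * u⁻¹) * g⁻¹).norm ≤ v.norm := by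
  set k := cancel u v with hk
  have hk' : cancel u⁻¹ v⁻¹ = k := by omega
  obtain ⟨-, -, e1⟩ := le_cancel_iff.1 hk.le
  obtain ⟨-, -, e2⟩ := le_cancel_iff.1 hk'.ge
  have hu : u.toWord.length = u.norm := rfl
  have hv : v.toWord.length = v.norm := rfl
  simp only [toWord_inv, invRev, List.take_reverse, List.length_map, List.reverse_inj,
    ← List.map_drop] at e2
  rw [List.map_inj_right] at e2
  swap
  · rintro ⟨a, b⟩ ⟨c, d⟩ h
    simpa using h
  set p := mk (u.toWord.take k)
  set q := mk (u.toWord.drop (u.toWord.length - k))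
  set r := mk ((v.toWord.drop k).take (v.norm - 2 * k))
  have eu : u = p * q := by
    conv_lhs => rw [← mk_toWord (x := u), ← List.take_append_drop k u.toWord]
    rw [← mul_mk]
    congr 3
    omega
  have ev : v = p * r * q := by
    have : v.toWord = u.toWord.take k ++ (v.toWord.drop k).take (v.norm - 2 * k) ++
        u.toWord.drop (u.toWord.length - k) := by
      rw [e1, e2]
      conv_lhs => rw [← List.take_append_drop k v.toWord,
        ← List.take_append_drop (v.norm - 2 * k) (v.toWord.drop k), List.drop_drop]
      rw [List.append_assoc]
      congr 3
      omega
    rw [← mk_toWord (x := v), this, ← mul_mk, ← mul_mk]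
  have hp : p.norm ≤ k := norm_mk_le.trans (by simp)
  have hq : q.norm ≤ k := norm_mk_le.trans (by rw [List.length_drop]; omega)
  have hr : r.norm ≤ v.norm - 2 * k := norm_mk_le.trans (by simp)
  refine ⟨p⁻¹, ?_⟩
  have a1 : p⁻¹ * u * p⁻¹⁻¹ = q * p := by rw [eu]; group
  have a2 : p⁻¹ * (v * u⁻¹) * p⁻¹⁻¹ = r := by rw [eu, ev]; group
  have := norm_mul_le q p
  rw [a1, a2]
  omega

/-- Local-to-global principle: if in each product of three consecutive letters the middle letter
is not completely cancelled, then the images of reduced words are at least as long as the words. -/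
theorem length_le_norm_lift_mk {ι : Type*} (f : ι × Bool → FreeGroup α)
    (hcore : ∀ l m n : ι × Bool, (l.1 = m.1 → l.2 = m.2) → (m.1 = n.1 → m.2 = n.2) →
      cancel (f l)⁻¹ (f m) + cancel (f m)⁻¹ (f n) < (f m).norm)
    {L : List (ι × Bool)} (hL : IsReduced L) : L.length ≤ (L.map f).prod.norm := by
  have key : ∀ (L : List (ι × Bool)) (m : ι × Bool), IsReduced (m :: L) →
      (∀ l : ι × Bool, (l.1 = m.1 → l.2 = m.2) →
        cancel (f l)⁻¹ (f m) < cancel (f m) ((m :: L).map f).prod) ∧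
      cancel (f m) ((m :: L).map f).prod + L.length ≤ ((m :: L).map f).prod.norm := by
    intro L
    induction L with
    | nil =>
      intro m _
      refine ⟨fun l hl => ?_, by simp [cancel_self]⟩
      have := hcore l m m hl (fun _ => rfl)
      simp only [List.map_cons, List.map_nil, List.prod_cons, List.prod_nil, mul_one, cancel_self]
      omega
    | cons m L ih =>
      intro l hlm
      rw [isReduced_cons_cons] at hlm
      obtain ⟨ih1, ih2⟩ := ih m hlm.2
      rw [List.map_cons, List.prod_cons]
      set P := ((m :: L).map f).prod
      have hlt := ih1 l hlm.1
      have hc : cancel (f l)⁻¹ P = cancel (f l)⁻¹ (f m) := by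
        have a := min_cancel_le (f l)⁻¹ (f m) P
        have b := min_cancel_le (f l)⁻¹ P (f m)
        rw [cancel_comm P (f m)] at b
        omega
      have n1 := norm_inv_mul_add (f l)⁻¹ P
      have n2 := norm_inv_mul_add (f l) (f l * P)
      rw [inv_inv, norm_inv_eq, hc] at n1
      rw [inv_mul_cancel_left] at n2
      refine ⟨fun k hk => ?_, ?_⟩
      · have := hcore k l m hk hlm.1
        omega
      · rw [List.length_cons]
        omega
  cases L with
  | nil => simp
  | cons m L =>
    obtain ⟨h1, h2⟩ := key L m hL
    have := h1 m (fun _ => rfl)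
    simp only [List.length_cons]
    omega

/-- A set `P` of pairs of nontrivial elements closed under Nielsen moves and simultaneous
conjugation, whose members all have total length at least `n`. -/
structure IsNielsenClosed (P : FreeGroup α → FreeGroup α → Prop) (n : ℕ) : Prop where
  swap : ∀ {u v}, P u v → P v u
  inv_left : ∀ {u v}, P u v → P u⁻¹ v
  mul_left : ∀ {u v}, P u v → P (u * v) v
  conj : ∀ {u v} (g), P u v → P (g * u * g⁻¹) (g * v * g⁻¹)
  left_ne_one : ∀ {u v}, P u v → u ≠ 1
  le_norm_add : ∀ {u v}, P u v → n ≤ u.norm + v.norm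

namespace IsNielsenClosed

variable {P : FreeGroup α → FreeGroup α → Prop} {n : ℕ}

theorem inv_right (hP : IsNielsenClosed P n) {u v : FreeGroup α} (h : P u v) : P u v⁻¹ :=
  hP.swap (hP.inv_left (hP.swap h))

theorem two_mul_cancel_le (hP : IsNielsenClosed P n) {u v : FreeGroup α} (h : P u v)
    (hn : u.norm + v.norm = n) : 2 * cancel u v ≤ u.norm ∧ 2 * cancel u v ≤ v.norm := by
  have h1 := hP.le_norm_add (hP.mul_left (hP.inv_left h))
  have h2 := hP.le_norm_add (hP.mul_left (hP.inv_left (hP.swap h)))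
  have h3 := norm_inv_mul_add u v
  have h4 := norm_inv_mul_add v u
  rw [cancel_comm v u] at h4
  omega

theorem cancel_add_cancel_inv_inv_lt (hP : IsNielsenClosed P n) {u v : FreeGroup α} (h : P u v)
    (hn : u.norm + v.norm = n) : cancel u v + cancel u⁻¹ v⁻¹ < u.norm := by
  obtain ⟨h1, h2⟩ := hP.two_mul_cancel_le h hn
  obtain ⟨h3, h4⟩ := hP.two_mul_cancel_le
    (hP.inv_right (hP.inv_left h)) (by simpa [norm_inv_eq] using hn)
  rw [norm_inv_eq] at h3 h4
  have hpos : 0 < u.norm := Nat.pos_of_ne_zero fun e => hP.left_ne_one h (norm_eq_zero.1 e)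
  by_contra! hle
  obtain ⟨g, hg⟩ := exists_shorter_of_half_cancel (u := u) (v := v) (by omega) (by omega) (by omega)
  have := hP.le_norm_add (hP.conj g (hP.inv_left (hP.swap (hP.mul_left (hP.inv_right (hP.swap h))))))
  rw [inv_inv] at this
  omega

theorem cancel_add_cancel_inv_left_lt (hP : IsNielsenClosed P n) {u v : FreeGroup α} (h : P u v)
    (hn : u.norm + v.norm = n) : cancel u v + cancel u⁻¹ v < u.norm := by
  obtain ⟨h1, h2⟩ := hP.two_mul_cancel_le h hn
  obtain ⟨h3, h4⟩ := hP.two_mul_cancel_le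
    (hP.inv_left h) (by simpa [norm_inv_eq] using hn)
  rw [norm_inv_eq] at h3
  have h5 := two_mul_cancel_inv_self_lt (hP.left_ne_one h)
  have h6 := min_cancel_le u⁻¹ v u
  rw [cancel_comm v u] at h6
  omega

theorem cancel_add_cancel_lt (hP : IsNielsenClosed P n) (f : Fin 2 × Bool → FreeGroup α)
    (hf : ∀ i b, f (i, !b) = (f (i, b))⁻¹) (h : P (f (0, true)) (f (1, true)))
    (hn : (f (0, true)).norm + (f (1, true)).norm = n)
    (l m k : Fin 2 × Bool) (hlm : l.1 = m.1 → l.2 = m.2) (hmk : m.1 = k.1 → m.2 = k.2) :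
    cancel (f l)⁻¹ (f m) + cancel (f m)⁻¹ (f k) < (f m).norm := by
  have hff : ∀ i, f (i, false) = (f (i, true))⁻¹ := fun i => hf i true
  have hpair : ∀ x y : Fin 2 × Bool, x.1 ≠ y.1 → P (f x) (f y) ∧ (f x).norm + (f y).norm = n := by
    rintro ⟨i, b⟩ ⟨j, c⟩ hij
    have h01 : i = 0 ∧ j = 1 ∨ i = 1 ∧ j = 0 := by
      replace hij : i ≠ j := hij
      omega
    rcases h01 with ⟨rfl, rfl⟩ | ⟨rfl, rfl⟩ <;> cases b <;> cases c <;>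
      (try simp only [hff, norm_inv_eq]) <;> refine ⟨?_, by omega⟩
    · exact hP.inv_left (hP.inv_right h)
    · exact hP.inv_left h
    · exact hP.inv_right h
    · exact h
    · exact hP.inv_left (hP.inv_right (hP.swap h))
    · exact hP.inv_left (hP.swap h)
    · exact hP.inv_right (hP.swap h)
    · exact hP.swap h
  have hm1 : f m ≠ 1 := by
    obtain ⟨j, hj⟩ := exists_ne m.1
    exact hP.left_ne_one (hpair m (j, true) hj.symm).1
  have hself := two_mul_cancel_inv_self_lt hm1
  have hhalf : ∀ x : Fin 2 × Bool, m.1 ≠ x.1 → 2 * cancel (f m)⁻¹ (f x) ≤ (f m).norm := by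
    intro x hx
    obtain ⟨h1, h2⟩ := hpair m x hx
    have := (hP.two_mul_cancel_le (hP.inv_left h1)
      (by rwa [norm_inv_eq])).1
    rwa [norm_inv_eq] at this
  have hhalf' : ∀ x : Fin 2 × Bool, m.1 ≠ x.1 → 2 * cancel (f x)⁻¹ (f m) ≤ (f m).norm := by
    intro x hx
    obtain ⟨h1, h2⟩ := hpair m x hx
    rw [cancel_comm]
    exact (hP.two_mul_cancel_le (hP.inv_right h1)
      (by rwa [norm_inv_eq])).1
  by_cases h1 : l.1 = m.1
  · obtain rfl : l = m := Prod.ext h1 (hlm h1)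
    by_cases h2 : l.1 = k.1
    · obtain rfl : l = k := Prod.ext h2 (hmk h2)
      omega
    · have := hhalf k h2
      omega
  · by_cases h2 : m.1 = k.1
    · obtain rfl : m = k := Prod.ext h2 (hmk h2)
      have := hhalf' l (Ne.symm h1)
      omega
    · have h3 : l.1 = k.1 := by omega
      obtain ⟨h4, h5⟩ := hpair m l (Ne.symm h1)
      rcases eq_or_ne l.2 k.2 with h6 | h6
      · obtain rfl : l = k := Prod.ext h3 h6
        have := hP.cancel_add_cancel_inv_inv_lt (hP.inv_right h4)
          (by rwa [norm_inv_eq])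
        rwa [inv_inv, cancel_comm (f m)] at this
      · have h7 : f k = (f l)⁻¹ := by
          rw [← hf]
          congr 1
          exact Prod.ext h3.symm (by cases hk : k.2 <;> cases hl : l.2 <;> simp_all)
        have := hP.cancel_add_cancel_inv_left_lt (hP.inv_right h4)
          (by rwa [norm_inv_eq])
        rwa [h7, cancel_comm (f l)⁻¹ (f m)]

end IsNielsenClosed

end FreeGroup

namespace FreeGroup

/-- The automorphism of a free group given by the images of the generators under it and
under its inverse. -/
def autOfImages {α : Type*} (f g : α → FreeGroup α) (hfg : ∀ i, lift g (f i) = of i)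
    (hgf : ∀ i, lift f (g i) = of i) : MulAut (FreeGroup α) :=
  MonoidHom.toMulEquiv (lift f) (lift g) (ext_hom _ _ fun i => by simp [hfg])
    (ext_hom _ _ fun i => by simp [hgf])

@[simp]
theorem autOfImages_of {α : Type*} (f g : α → FreeGroup α)
    (hfg : ∀ i, lift g (f i) = of i) (hgf : ∀ i, lift f (g i) = of i) (i : α) :
    autOfImages f g hfg hgf (of i) = f i := by
  simp [autOfImages]

theorem mulAut_ext {α : Type*} {φ ψ : MulAut (FreeGroup α)}
    (h : ∀ i, φ (of i) = ψ (of i)) : φ = ψ :=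
  MulEquiv.toMonoidHom_injective (ext_hom _ _ h)

end FreeGroup

namespace FreeGroupTwo

open FreeGroup

/-- The automorphism exchanging the two generators. -/
def swapAut : MulAut (FreeGroup (Fin 2)) :=
  autOfImages ![of 1, of 0] ![of 1, of 0]
    (by simp [Fin.forall_fin_two]) (by simp [Fin.forall_fin_two])

/-- The automorphism inverting the second generator. -/
def invAut : MulAut (FreeGroup (Fin 2)) :=
  autOfImages ![of 0, (of 1)⁻¹] ![of 0, (of 1)⁻¹]
    (by simp [Fin.forall_fin_two]) (by simp [Fin.forall_fin_two])

/-- The automorphism multiplying the first generator on the right by the second one. -/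
def transvection : MulAut (FreeGroup (Fin 2)) :=
  autOfImages ![of 0 * of 1, of 1] ![of 0 * (of 1)⁻¹, of 1]
    (by simp [Fin.forall_fin_two]) (by simp [Fin.forall_fin_two])

@[simp] theorem swapAut_of_zero : swapAut (of 0) = of 1 := by simp [swapAut]
@[simp] theorem swapAut_of_one : swapAut (of 1) = of 0 := by simp [swapAut]
@[simp] theorem invAut_of_zero : invAut (of 0) = of 0 := by simp [invAut]
@[simp] theorem invAut_of_one : invAut (of 1) = (of 1)⁻¹ := by simp [invAut]
@[simp] theorem transvection_of_zero : transvection (of 0) = of 0 * of 1 := by simp [transvection]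
@[simp] theorem transvection_of_one : transvection (of 1) = of 1 := by simp [transvection]

theorem swapAut_mul_self : swapAut * swapAut = 1 :=
  mulAut_ext (by simp [Fin.forall_fin_two])

theorem invAut_mul_self : invAut * invAut = 1 :=
  mulAut_ext (by simp [Fin.forall_fin_two])

@[simp] theorem swapAut_inv : swapAut⁻¹ = swapAut := inv_eq_of_mul_eq_one_left swapAut_mul_self

@[simp] theorem invAut_inv : invAut⁻¹ = invAut := inv_eq_of_mul_eq_one_left invAut_mul_self

/-- An automorphism of `F₂` is signed if it maps generators to generators or their inverses. -/
def IsSigned (φ : MulAut (FreeGroup (Fin 2))) : Prop :=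
  ∀ j, ∃ k, φ (of j) = of k ∨ φ (of j) = (of k)⁻¹

theorem IsSigned.mem_closure {φ : MulAut (FreeGroup (Fin 2))} (h : IsSigned φ) :
    φ ∈ Subgroup.closure {swapAut, invAut} := by
  have hs : swapAut ∈ Subgroup.closure {swapAut, invAut} := Subgroup.subset_closure (by simp)
  have he : invAut ∈ Subgroup.closure {swapAut, invAut} := Subgroup.subset_closure (by simp)
  have hne : φ (of 0) ≠ φ (of 1) := fun e => by
    simpa using of_injective (φ.injective e)
  have hne' : φ (of 0) ≠ φ ((of 1)⁻¹) := fun e => by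
    have := φ.injective e
    revert this
    decide
  have key : ∀ ψ, ψ ∈ Subgroup.closure {swapAut, invAut} → φ (of 0) = ψ (of 0) →
      φ (of 1) = ψ (of 1) → φ ∈ Subgroup.closure {swapAut, invAut} := by
    intro ψ hψ h0 h1
    rwa [mulAut_ext (φ := φ) (ψ := ψ) (by simp [Fin.forall_fin_two, h0, h1])]
  rw [_root_.map_inv] at hne'
  obtain ⟨k, hk⟩ := h 0
  obtain ⟨m, hm⟩ := h 1
  fin_cases k <;> fin_cases m <;> simp only [Fin.zero_eta, Fin.mk_one] at hk hm <;>
    rcases hk with hk | hk <;> rcases hm with hm | hm <;> (try simp [hk, hm] at hne hne')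
  · exact key 1 (one_mem _) (by simp [hk]) (by simp [hm])
  · exact key invAut he (by simp [hk]) (by simp [hm])
  · exact key (swapAut * invAut * swapAut) (mul_mem (mul_mem hs he) hs)
      (by simp [hk]) (by simp [hm])
  · exact key (invAut * (swapAut * invAut * swapAut)) (mul_mem he (mul_mem (mul_mem hs he) hs))
      (by simp [hk]) (by simp [hm])
  · exact key swapAut hs (by simp [hk]) (by simp [hm])
  · exact key (swapAut * invAut) (mul_mem hs he) (by simp [hk]) (by simp [hm])
  · exact key (invAut * swapAut) (mul_mem he hs) (by simp [hk]) (by simp [hm])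
  · exact key (invAut * swapAut * invAut) (mul_mem (mul_mem he hs) he)
      (by simp [hk]) (by simp [hm])

theorem isSigned_of_mem_closure {φ : MulAut (FreeGroup (Fin 2))}
    (h : φ ∈ Subgroup.closure {swapAut, invAut}) : IsSigned φ := by
  have key : ∀ ψ, ∀ χ ∈ ({swapAut, invAut} : Set (MulAut (FreeGroup (Fin 2)))),
      IsSigned ψ → IsSigned (ψ * χ) := by
    rintro ψ χ (rfl | rfl) hψ
    · exact Fin.forall_fin_two.2 ⟨by simpa only [MulAut.mul_apply, swapAut_of_zero] using hψ 1,
        by simpa only [MulAut.mul_apply, swapAut_of_one] using hψ 0⟩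
    · obtain ⟨k, hk⟩ := hψ 1
      refine Fin.forall_fin_two.2
        ⟨by simpa only [MulAut.mul_apply, invAut_of_zero] using hψ 0, k, ?_⟩
      rcases hk with hk | hk <;> simp [hk]
  induction h using Subgroup.closure_induction_right with
  | one => exact fun j => ⟨j, Or.inl rfl⟩
  | mul_right ψ _ χ hχ ih => exact key ψ χ hχ ih
  | mul_inv_cancel ψ _ χ hχ ih =>
    have : χ⁻¹ = χ := by rcases hχ with rfl | rfl <;> simp
    rw [this]
    exact key ψ χ hχ ih

/-- **Nielsen's theorem** in rank two: inner automorphisms, signed permutations of the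
generators and one transvection generate the automorphism group of the free group. -/
theorem eq_top_of_mem {H : Subgroup (MulAut (FreeGroup (Fin 2)))}
    (hinn : (MulAut.conj : FreeGroup (Fin 2) →* _).range ≤ H) (hs : swapAut ∈ H)
    (he : invAut ∈ H) (ht : transvection ∈ H) : H = ⊤ := by
  by_contra hH
  obtain ⟨φ₀, hφ₀⟩ : ∃ φ, φ ∉ H := by
    by_contra! h
    exact hH ((Subgroup.eq_top_iff' H).2 h)
  set P : FreeGroup (Fin 2) → FreeGroup (Fin 2) → Prop := fun u v =>
    ∃ φ, φ ∉ H ∧ φ (of 0) = u ∧ φ (of 1) = v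
  have hex : ∃ n, ∃ u v, P u v ∧ u.norm + v.norm = n := ⟨_, _, _, ⟨φ₀, hφ₀, rfl, rfl⟩, rfl⟩
  classical
  obtain ⟨u, v, ⟨φ, hφ, hu, hv⟩, hn⟩ := Nat.find_spec hex
  have hP : IsNielsenClosed P (Nat.find hex) := by
    constructor
    · rintro _ _ ⟨ψ, hψ, rfl, rfl⟩
      exact ⟨ψ * swapAut, by rwa [H.mul_mem_cancel_right hs], by simp, by simp⟩
    · rintro _ _ ⟨ψ, hψ, rfl, rfl⟩
      exact ⟨ψ * (swapAut * invAut * swapAut),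
        by rwa [H.mul_mem_cancel_right (mul_mem (mul_mem hs he) hs)], by simp, by simp⟩
    · rintro _ _ ⟨ψ, hψ, rfl, rfl⟩
      exact ⟨ψ * transvection, by rwa [H.mul_mem_cancel_right ht], by simp, by simp⟩
    · rintro _ _ g ⟨ψ, hψ, rfl, rfl⟩
      exact ⟨MulAut.conj g * ψ, by rwa [H.mul_mem_cancel_left (hinn ⟨g, rfl⟩)], by simp, by simp⟩
    · rintro _ _ ⟨ψ, hψ, rfl, rfl⟩
      simp
    · exact fun {u v} h => Nat.find_min' hex ⟨u, v, h, rfl⟩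
  set f : Fin 2 × Bool → FreeGroup (Fin 2) := fun x =>
    cond x.2 (φ (of x.1)) (φ (of x.1))⁻¹ with hf
  have hcore := hP.cancel_add_cancel_lt f (by rintro i (_ | _) <;> simp [hf])
    ⟨φ, hφ, rfl, rfl⟩ (by simpa [hf, hu, hv] using hn)
  have hnorm : ∀ w : FreeGroup (Fin 2), w.norm ≤ (φ w).norm := by
    intro w
    have h1 := length_le_norm_lift_mk f hcore (isReduced_toWord (x := w))
    have h2 : lift (fun i => φ (of i)) = φ.toMonoidHom := ext_hom _ _ fun i => by simp
    have h3 : φ w = (w.toWord.map f).prod := by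
      have := congrArg (fun χ => χ w) h2
      conv_lhs at this => rw [← mk_toWord (x := w)]
      simpa [hf] using this.symm
    rw [h3]
    exact h1
  have hsigned : IsSigned φ⁻¹ := by
    intro j
    have h1 := hnorm (φ⁻¹ (of j))
    rw [MulAut.apply_inv_self, norm_of] at h1
    have h2 : φ⁻¹ (of j) ≠ 1 := by simp
    have h3 : (φ⁻¹ (of j)).norm = 1 := by
      have : (φ⁻¹ (of j)).norm ≠ 0 := fun h => h2 (norm_eq_zero.1 h)
      omega
    obtain ⟨⟨k, b⟩, hk⟩ := List.length_eq_one_iff.1 h3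
    rw [← mk_toWord (x := φ⁻¹ (of j)), hk]
    refine ⟨k, ?_⟩
    cases b
    · exact Or.inr rfl
    · exact Or.inl rfl
  have hle : Subgroup.closure {swapAut, invAut} ≤ H := by
    rw [Subgroup.closure_le]
    rintro _ (rfl | rfl) <;> assumption
  exact hφ (inv_mem_iff.1 (hle hsigned.mem_closure))

/-- A group generated by two involutions `s`, `e` and an element `t`, subject to the relations
below, is the product of the submonoid generated by `t` and its conjugate by `s` with the
subgroup generated by `s` and `e` on both sides. -/
theorem exists_eq_mul_mul_of_mem_closure {G : Type*} [Group G] {s e t : G} (hs : s * s = 1)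
    (he : e * e = 1) (het : e * t * e⁻¹ = t⁻¹) (her : e * (s * t * s⁻¹) * e⁻¹ = (s * t * s⁻¹)⁻¹)
    (hrt : s * t * s⁻¹ * t⁻¹ = t * e * s) {g : G} (hg : g ∈ Subgroup.closure {s, e, t}) :
    ∃ d ∈ Subgroup.closure {s, e}, ∃ p ∈ Submonoid.closure {t, s * t * s⁻¹},
      ∃ d' ∈ Subgroup.closure {s, e}, g = d * p * d' := by
  set r := s * t * s⁻¹ with hr
  have hsD : s ∈ Subgroup.closure {s, e} := Subgroup.subset_closure (by simp)
  have heD : e ∈ Subgroup.closure {s, e} := Subgroup.subset_closure (by simp)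
  have htP : t ∈ Submonoid.closure {t, r} := Submonoid.subset_closure (by simp)
  have hrP : r ∈ Submonoid.closure {t, r} := Submonoid.subset_closure (by simp)
  have hs' : s⁻¹ = s := inv_eq_of_mul_eq_one_left hs
  have he' : e⁻¹ = e := inv_eq_of_mul_eq_one_left he
  have hsr : s * r * s⁻¹ = t := by
    rw [hr, hs', ← mul_assoc, ← mul_assoc, hs, one_mul, mul_assoc, hs, mul_one]
  have htr : t * r⁻¹ = r * s * e := by
    have h1 : t * r⁻¹ = s * (r * t⁻¹) * s⁻¹ := by
      conv_lhs => rw [← hsr]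
      nth_rw 2 [hr]
      group
    rw [h1, hrt, hr]
    group
  set C : Set G := {t, t⁻¹, r, r⁻¹} with hC
  have hCs : ∀ c ∈ C, s * c * s⁻¹ ∈ C := by
    rintro c (rfl | rfl | rfl | rfl)
    · simp [hC, ← hr]
    · simp [hC, ← conj_inv, ← hr]
    · simp [hC, hsr]
    · simp [hC, ← conj_inv, hsr]
  have hCe : ∀ c ∈ C, e * c * e⁻¹ ∈ C := by
    rintro c (rfl | rfl | rfl | rfl)
    · simp [hC, het]
    · simp [hC, ← conj_inv, het]
    · simp [hC, her]
    · simp [hC, ← conj_inv, her]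
  have hCD : ∀ d ∈ Subgroup.closure {s, e}, ∀ c ∈ C, d * c * d⁻¹ ∈ C := by
    have key : ∀ x ∈ ({s, e} : Set G), ∀ y, (∀ c ∈ C, y * c * y⁻¹ ∈ C) →
        ∀ c ∈ C, x * y * c * (x * y)⁻¹ ∈ C := by
      intro x hx y ih c hc
      have : x * y * c * (x * y)⁻¹ = x * (y * c * y⁻¹) * x⁻¹ := by group
      rw [this]
      rcases hx with rfl | rfl
      · exact hCs _ (ih c hc)
      · exact hCe _ (ih c hc)
    intro d hd
    induction hd using Subgroup.closure_induction_left with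
    | one => simp
    | mul_left x hx y _ ih => exact key x hx y ih
    | inv_mul_cancel x hx y _ ih =>
      have : x⁻¹ = x := by rcases hx with rfl | rfl <;> assumption
      rw [this]
      exact key x hx y ih
  have hPC : ∀ p ∈ Submonoid.closure {t, r}, ∀ c ∈ C, ∃ d ∈ Subgroup.closure {s, e},
      ∃ p' ∈ Submonoid.closure {t, r}, ∃ d' ∈ Subgroup.closure {s, e}, p * c = d * p' * d' := by
    have hone := one_mem (Subgroup.closure {s, e})
    intro p hp
    induction hp using Submonoid.closure_induction_right with
    | one =>
      rintro c (rfl | rfl | rfl | rfl)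
      · exact ⟨1, hone, _, htP, 1, hone, by group⟩
      · exact ⟨e, heD, t, htP, e⁻¹, inv_mem heD, by rw [het, one_mul]⟩
      · exact ⟨1, hone, r, hrP, 1, hone, by group⟩
      · exact ⟨e, heD, r, hrP, e⁻¹, inv_mem heD, by rw [her, one_mul]⟩
    | mul_right x hx y hy _ =>
      have hxy := mul_mem hx (Submonoid.subset_closure hy)
      rintro c (rfl | rfl | rfl | rfl)
      · exact ⟨1, hone, _, mul_mem hxy htP, 1, hone, by group⟩
      · rcases hy with rfl | rfl
        · exact ⟨1, hone, x, hx, 1, hone, by group⟩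
        · exact ⟨1, hone, x * t, mul_mem hx htP, e * s, mul_mem heD hsD, by
            rw [mul_assoc, hrt]; group⟩
      · exact ⟨1, hone, x * y * r, mul_mem hxy hrP, 1, hone, by group⟩
      · rcases hy with rfl | rfl
        · exact ⟨1, hone, x * r, mul_mem hx hrP, s * e, mul_mem hsD heD, by
            rw [mul_assoc, htr]; group⟩
        · exact ⟨1, hone, x, hx, 1, hone, by group⟩
  have hmulD : ∀ g, ∀ c ∈ Subgroup.closure {s, e}, (∃ d ∈ Subgroup.closure {s, e},
      ∃ p ∈ Submonoid.closure {t, r}, ∃ d' ∈ Subgroup.closure {s, e}, g = d * p * d') →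
      ∃ d ∈ Subgroup.closure {s, e}, ∃ p ∈ Submonoid.closure {t, r},
      ∃ d' ∈ Subgroup.closure {s, e}, g * c = d * p * d' := by
    rintro _ c hc ⟨d, hd, p, hp, d', hd', rfl⟩
    exact ⟨d, hd, p, hp, d' * c, mul_mem hd' hc, by group⟩
  have hmulC : ∀ g, ∀ c ∈ C, (∃ d ∈ Subgroup.closure {s, e},
      ∃ p ∈ Submonoid.closure {t, r}, ∃ d' ∈ Subgroup.closure {s, e}, g = d * p * d') →
      ∃ d ∈ Subgroup.closure {s, e}, ∃ p ∈ Submonoid.closure {t, r},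
      ∃ d' ∈ Subgroup.closure {s, e}, g * c = d * p * d' := by
    rintro _ c hc ⟨d, hd, p, hp, d', hd', rfl⟩
    obtain ⟨d₁, hd₁, p₁, hp₁, d₂, hd₂, h⟩ := hPC p hp _ (hCD d' hd' c hc)
    refine ⟨d * d₁, mul_mem hd hd₁, p₁, hp₁, d₂ * d', mul_mem hd₂ hd', ?_⟩
    calc d * p * d' * c = d * (p * (d' * c * d'⁻¹)) * d' := by group
      _ = d * d₁ * p₁ * (d₂ * d') := by rw [h]; group
  induction hg using Subgroup.closure_induction_right with
  | one => exact ⟨1, one_mem _, 1, one_mem _, 1, one_mem _, by simp⟩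
  | mul_right x _ y hy ih =>
    rcases hy with rfl | rfl | rfl
    · exact hmulD _ _ hsD ih
    · exact hmulD _ _ heD ih
    · exact hmulC _ _ (by simp [hC]) ih
  | mul_inv_cancel x _ y hy ih =>
    rcases hy with rfl | rfl | rfl
    · exact hmulD _ _ (inv_mem hsD) ih
    · exact hmulD _ _ (inv_mem heD) ih
    · exact hmulC _ _ (by simp [hC]) ih

theorem expSum_of (i j : Fin 2) :
    (expSum i (of j)).toAdd = if j = i then (1 : ℤ) else 0 := by
  simp [expSum]

theorem toAdd_expSum_apply (φ : MulAut (FreeGroup (Fin 2))) (i : Fin 2) (w : FreeGroup (Fin 2)) :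
    (expSum i (φ w)).toAdd =
      ∑ k, (expSum i (φ (of k))).toAdd * (expSum k w).toAdd := by
  induction w using FreeGroup.induction_on with
  | C1 => simp
  | of j => simp [expSum_of]
  | inv_of j ih => simp_all
  | mul x y hx hy => simp_all [mul_add]; ring

/-- The action of an automorphism of `F₂` on the abelianization, as a matrix. -/
def abelMatrix : MulAut (FreeGroup (Fin 2)) →* Matrix (Fin 2) (Fin 2) ℤ where
  toFun φ := Matrix.of fun i j => (expSum i (φ (of j))).toAdd
  map_one' := by
    ext i j
    simp [expSum_of, Matrix.one_apply, eq_comm]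
  map_mul' φ ψ := by
    ext i j
    rw [Matrix.mul_apply]
    exact toAdd_expSum_apply φ i (ψ (of j))

/-- The natural homomorphism `Aut(F₂) → GL₂(ℤ)`. -/
def abelGL : MulAut (FreeGroup (Fin 2)) →* Matrix.GeneralLinearGroup (Fin 2) ℤ :=
  abelMatrix.toHomUnits

theorem coe_abelGL_apply (φ : MulAut (FreeGroup (Fin 2))) (i j : Fin 2) :
    (abelGL φ : Matrix (Fin 2) (Fin 2) ℤ) i j = (expSum i (φ (of j))).toAdd := rfl

theorem coe_abelGL_transvection :
    (abelGL transvection : Matrix (Fin 2) (Fin 2) ℤ) = !![1, 0; 1, 1] := by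
  ext i j
  rw [coe_abelGL_apply]
  fin_cases i <;> fin_cases j <;> simp [expSum_of]

theorem coe_abelGL_swapAut :
    (abelGL swapAut : Matrix (Fin 2) (Fin 2) ℤ) = !![0, 1; 1, 0] := by
  ext i j
  rw [coe_abelGL_apply]
  fin_cases i <;> fin_cases j <;> simp [expSum_of]

theorem coe_abelGL_invAut :
    (abelGL invAut : Matrix (Fin 2) (Fin 2) ℤ) = !![1, 0; 0, -1] := by
  ext i j
  rw [coe_abelGL_apply]
  fin_cases i <;> fin_cases j <;> simp [expSum_of]

theorem abelGL_surjective : Function.Surjective abelGL := by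
  rw [← MonoidHom.range_eq_top, Subgroup.eq_top_iff']
  have hS : (ModularGroup.S : Matrix.GeneralLinearGroup (Fin 2) ℤ) = abelGL (invAut * swapAut)⁻¹ := by
    rw [_root_.map_inv, eq_inv_iff_mul_eq_one]
    apply Units.ext
    rw [_root_.map_mul, Units.val_mul, Matrix.SpecialLinearGroup.coe_GL_coe_matrix, Units.val_mul, coe_abelGL_swapAut, coe_abelGL_invAut]
    ext i j
    fin_cases i <;> fin_cases j <;> simp [ModularGroup.S]
  have hT : (ModularGroup.T : Matrix.GeneralLinearGroup (Fin 2) ℤ) =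
      abelGL (swapAut * transvection * swapAut) := by
    apply Units.ext
    simp only [Matrix.SpecialLinearGroup.coe_GL_coe_matrix, _root_.map_mul, Units.val_mul, coe_abelGL_swapAut, coe_abelGL_transvection]
    ext i j
    fin_cases i <;> fin_cases j <;> simp [ModularGroup.T]
  have hSL : ∀ A : Matrix.SpecialLinearGroup (Fin 2) ℤ,
      (A : Matrix.GeneralLinearGroup (Fin 2) ℤ) ∈ abelGL.range := by
    intro A
    have hA : A ∈ Subgroup.closure {ModularGroup.S, ModularGroup.T} := by
      rw [SpecialLinearGroup.SL2Z_generators]; trivial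
    have hle : Subgroup.closure {ModularGroup.S, ModularGroup.T} ≤
        abelGL.range.comap Matrix.SpecialLinearGroup.toGL := by
      rw [Subgroup.closure_le]
      rintro _ (rfl | rfl)
      · exact ⟨_, hS.symm⟩
      · exact ⟨_, hT.symm⟩
    exact hle hA
  intro M
  have hdet := Int.isUnit_iff.1 ((Matrix.isUnit_iff_isUnit_det (M : Matrix (Fin 2) (Fin 2) ℤ)).1
    M.isUnit)
  rcases hdet with h | h
  · convert hSL ⟨M, h⟩
    ext i j
    rfl
  · rw [← Subgroup.mul_mem_cancel_right _ (⟨invAut, rfl⟩ : abelGL invAut ∈ abelGL.range)]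
    convert hSL ⟨(M * abelGL invAut : Matrix.GeneralLinearGroup (Fin 2) ℤ), by
      rw [Units.val_mul, Matrix.det_mul, h, coe_abelGL_invAut, Matrix.det_fin_two]; simp⟩
    ext i j
    rfl

theorem abelGL_conj (g : FreeGroup (Fin 2)) : abelGL (MulAut.conj g) = 1 := by
  apply Units.ext
  ext i j
  rw [coe_abelGL_apply]
  simp [expSum_of, Matrix.one_apply, eq_comm]

theorem conj_range_normal {G : Type*} [Group G] : (MulAut.conj : G →* MulAut G).range.Normal where
  conj_mem := by
    rintro _ ⟨g, rfl⟩ φ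
    exact ⟨φ g, by ext x; simp⟩

theorem IsSigned.eq_one {φ : MulAut (FreeGroup (Fin 2))} (h : IsSigned φ) (h1 : abelGL φ = 1) :
    φ = 1 := by
  refine mulAut_ext fun j => ?_
  have key : ∀ i, (expSum i (φ (of j))).toAdd = if j = i then (1 : ℤ) else 0 := by
    intro i
    rw [← coe_abelGL_apply, h1]
    simp [Matrix.one_apply, eq_comm]
  obtain ⟨k, hk | hk⟩ := h j
  · have := key j
    rw [hk, expSum_of] at this
    simp only [if_true, ite_eq_left_iff, zero_ne_one, imp_false, not_not] at this
    simp [hk, this]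
  · have := key j
    rw [hk, _root_.map_inv, toAdd_inv, expSum_of] at this
    split_ifs at this <;> omega

theorem IsSigned.sum_le {φ : MulAut (FreeGroup (Fin 2))} (h : IsSigned φ) :
    ∑ j, ∑ i, (abelGL φ : Matrix (Fin 2) (Fin 2) ℤ) i j ≤ 2 := by
  have key : ∀ j, ∑ i, (abelGL φ : Matrix (Fin 2) (Fin 2) ℤ) i j ≤ 1 := by
    intro j
    simp only [coe_abelGL_apply]
    obtain ⟨k, hk | hk⟩ := h j <;> simp [hk, expSum_of]
  calc _ ≤ ∑ j : Fin 2, (1 : ℤ) := Finset.sum_le_sum fun j _ => key j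
    _ = 2 := by simp

theorem eq_one_of_mem_closure_of_sum_le {p : MulAut (FreeGroup (Fin 2))}
    (hp : p ∈ Submonoid.closure {transvection, swapAut * transvection * swapAut⁻¹})
    (hsum : ∑ j, ∑ i, (abelGL p : Matrix (Fin 2) (Fin 2) ℤ) i j ≤ 2) : p = 1 := by
  have key : (∀ j, 1 ≤ ∑ i, (abelGL p : Matrix (Fin 2) (Fin 2) ℤ) i j) ∧
      (p = 1 ∨ 3 ≤ ∑ j, ∑ i, (abelGL p : Matrix (Fin 2) (Fin 2) ℤ) i j) := by
    clear hsum
    induction hp using Submonoid.closure_induction_right with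
    | one => simp [Fin.forall_fin_two]
    | mul_right x _ y hy ih =>
      obtain ⟨ih1, -⟩ := ih
      rw [Fin.forall_fin_two] at ih1 ⊢
      simp only [Fin.sum_univ_two] at ih1 ⊢
      rcases hy with rfl | rfl <;>
        simp [coe_abelGL_transvection, coe_abelGL_swapAut, Matrix.mul_apply] <;> omega
  rcases key.2 with h | h
  · exact h
  · omega

theorem abelGL_ker : abelGL.ker = (MulAut.conj :
    FreeGroup (Fin 2) →* MulAut (FreeGroup (Fin 2))).range := by
  set N := (MulAut.conj : FreeGroup (Fin 2) →* MulAut (FreeGroup (Fin 2))).range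
  have : N.Normal := conj_range_normal
  have hle : N ≤ abelGL.ker := by
    rintro _ ⟨g, rfl⟩
    exact abelGL_conj g
  refine le_antisymm (fun φ hφ => ?_) hle
  set π := QuotientGroup.mk' N
  have hπ1 : ∀ ψ, π ψ = 1 ↔ ψ ∈ N := fun ψ => QuotientGroup.eq_one_iff ψ
  have hAeq : ∀ ψ χ, π ψ = π χ → abelGL ψ = abelGL χ := by
    intro ψ χ h
    have : ψ⁻¹ * χ ∈ N := QuotientGroup.eq.1 h
    have := hle this
    rw [MonoidHom.mem_ker, _root_.map_mul, _root_.map_inv, inv_mul_eq_one] at this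
    exact this
  have hπeq : ∀ g ψ χ, ψ = MulAut.conj g * χ → π ψ = π χ := by
    rintro g _ χ rfl
    rw [_root_.map_mul, (hπ1 _).2 ⟨g, rfl⟩, one_mul]
  have hs : π swapAut * π swapAut = 1 := by
    rw [← _root_.map_mul, swapAut_mul_self, _root_.map_one]
  have he : π invAut * π invAut = 1 := by
    rw [← _root_.map_mul, invAut_mul_self, _root_.map_one]
  have het : π invAut * π transvection * (π invAut)⁻¹ = (π transvection)⁻¹ := by
    rw [eq_inv_iff_mul_eq_one]
    simp only [← _root_.map_mul, ← _root_.map_inv]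
    rw [← _root_.map_one π]
    exact congrArg π (mulAut_ext (by simp [Fin.forall_fin_two]))
  have her : π invAut * (π swapAut * π transvection * (π swapAut)⁻¹) * (π invAut)⁻¹ =
      (π swapAut * π transvection * (π swapAut)⁻¹)⁻¹ := by
    rw [eq_inv_iff_mul_eq_one]
    simp only [← _root_.map_mul, ← _root_.map_inv]
    rw [← _root_.map_one π]
    exact hπeq (of 0)⁻¹ _ _ (mulAut_ext (by simp [Fin.forall_fin_two, mul_assoc]))
  have hrt : π swapAut * π transvection * (π swapAut)⁻¹ * (π transvection)⁻¹ =
      π transvection * π invAut * π swapAut := by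
    rw [mul_inv_eq_iff_eq_mul]
    simp only [← _root_.map_mul, ← _root_.map_inv]
    exact hπeq (of 1) _ _ (mulAut_ext (by simp [Fin.forall_fin_two, mul_assoc]))
  have htop : (Subgroup.closure {π swapAut, π invAut, π transvection}).comap π = ⊤ := by
    refine eq_top_of_mem ?_ ?_ ?_ ?_
    · intro ψ hψ
      rw [Subgroup.mem_comap, (hπ1 ψ).2 hψ]
      exact one_mem _
    all_goals exact Subgroup.subset_closure (by simp)
  have hmem : π φ ∈ Subgroup.closure {π swapAut, π invAut, π transvection} := by
    rw [← Subgroup.mem_comap, htop]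
    trivial
  have hD : ∀ d ∈ Subgroup.closure {π swapAut, π invAut}, ∃ ψ, IsSigned ψ ∧ π ψ = d := by
    intro d hd
    rw [← Set.image_pair, ← MonoidHom.map_closure] at hd
    obtain ⟨ψ, hψ, rfl⟩ := hd
    exact ⟨ψ, isSigned_of_mem_closure hψ, rfl⟩
  obtain ⟨d, hd, p, hp, d', hd', h⟩ := exists_eq_mul_mul_of_mem_closure hs he het her hrt hmem
  rw [← _root_.map_inv, ← _root_.map_mul, ← _root_.map_mul, ← Set.image_pair,
    ← MonoidHom.map_mclosure] at hp
  obtain ⟨p, hp, rfl⟩ := hp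
  obtain ⟨ψ, hψ, hψd⟩ := hD _ (mul_mem (inv_mem hd) (inv_mem hd'))
  obtain ⟨χ, hχ, hχd⟩ := hD _ (mul_mem hd hd')
  have hAp : abelGL p = abelGL ψ := by
    obtain ⟨ψ₁, -, rfl⟩ := hD d hd
    obtain ⟨ψ₂, -, rfl⟩ := hD d' hd'
    simp only [← _root_.map_mul, ← _root_.map_inv] at h hψd
    have h1 := hAeq _ _ h
    rw [MonoidHom.mem_ker.1 hφ, _root_.map_mul, _root_.map_mul, eq_comm, mul_eq_one_iff_eq_inv,
      ← eq_inv_mul_iff_mul_eq] at h1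
    rw [hAeq _ _ hψd, h1, _root_.map_mul, _root_.map_inv, _root_.map_inv]
  have hp1 := eq_one_of_mem_closure_of_sum_le hp (by rw [hAp]; exact hψ.sum_le)
  have hφχ : π φ = π χ := by
    rw [h, hp1, hχd, _root_.map_one, mul_one]
  rw [MonoidHom.mem_ker, hAeq _ _ hφχ] at hφ
  rw [← hπ1, hφχ, hχ.eq_one hφ, _root_.map_one]

end FreeGroupTwo

/-- The natural homomorphism `Aut(F₂) → GL₂(ℤ)` — sending an automorphism `φ`
to the matrix of the induced action on the abelianization `ℤ²` of `F₂`, whose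
`(i,j)` entry is the exponent sum of the `i`-th generator in `φ` applied to the
`j`-th generator — is surjective, and its kernel is exactly the group of inner
automorphisms of `F₂` (the range of `MulAut.conj`). Consequently
`Out(F₂) = Aut(F₂)/Inn(F₂) ≅ GL₂(ℤ)`. -/
theorem stmt15 :
    ∃ Φ : MulAut (FreeGroup (Fin 2)) →* Matrix.GeneralLinearGroup (Fin 2) ℤ,
      (∀ (φ : MulAut (FreeGroup (Fin 2))) (i j : Fin 2),
        ((Φ φ : Matrix (Fin 2) (Fin 2) ℤ)) i j =
          Multiplicative.toAdd (expSum i (φ (FreeGroup.of j)))) ∧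
      Function.Surjective Φ ∧
      Φ.ker = (MulAut.conj :
        FreeGroup (Fin 2) →* MulAut (FreeGroup (Fin 2))).range ∧
      (∀ [inst : ((MulAut.conj :
            FreeGroup (Fin 2) →* MulAut (FreeGroup (Fin 2))).range).Normal],
        Nonempty ((MulAut (FreeGroup (Fin 2)) ⧸ (MulAut.conj :
            FreeGroup (Fin 2) →* MulAut (FreeGroup (Fin 2))).range) ≃*
          Matrix.GeneralLinearGroup (Fin 2) ℤ)) := by
  have hker := FreeGroupTwo.abelGL_ker
  refine ⟨FreeGroupTwo.abelGL, FreeGroupTwo.coe_abelGL_apply, FreeGroupTwo.abelGL_surjective,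
    hker, fun {_} => ⟨?_⟩⟩
  exact (QuotientGroup.quotientMulEquivOfEq hker.symm).trans
    (QuotientGroup.quotientKerEquivOfSurjective _ FreeGroupTwo.abelGL_surjective)
end
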